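/- arXiv:2011.06849 — 3 statements merged into one kernel-verified Lean document; each statement's English description precedes it below -/
import Mathlib

section
/- (Theorem 1, case l = 1: a 1-time ε-secure MAC needs key length at least 2·|log₂ ε|.) Let ε > 0 and assume |M| ≥ 2. Suppose (impersonation security) for every m ∈ M and t ∈ T, |{k ∈ K : h(k,m) = t}| ≤ ε·|K|, and (substitution security) for all messages m ≠ m′ and all tags t, t′, |{k ∈ K : h(k,m) = t and h(k,m′) = t′}| ≤ ε·|{k ∈ K : h(k,m) = t}|. Then |K| ≥ 1/ε², i.e., the key length log₂|K| is at least 2·|log₂ ε|. -/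
open Finset

/-- Theorem 1 for `l = 1`: a 1-time ε-secure MAC (secure against both impersonation and
substitution at level ε) must have `|K| ≥ 1/ε²`, i.e. key length at least `2·|log₂ ε|`. -/
theorem mac_one_time_key_bound
    {K M T : Type*} [Fintype K] [Fintype M] [Fintype T] [DecidableEq T]
    [Nonempty K] [Nonempty T]
    (h : K → M → T) (ε : ℝ) (hε : 0 < ε)
    (hM : 2 ≤ Fintype.card M)
    (himp : ∀ (m : M) (t : T),
      ((Finset.univ.filter (fun k : K => h k m = t)).card : ℝ) ≤ ε * Fintype.card K)
    (hsub : ∀ (m m' : M), m ≠ m' → ∀ (t t' : T),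
      ((Finset.univ.filter (fun k : K => h k m = t ∧ h k m' = t')).card : ℝ) ≤
        ε * (Finset.univ.filter (fun k : K => h k m = t)).card) :
    (Fintype.card K : ℝ) ≥ 1 / ε ^ 2 := by
  obtain ⟨k⟩ := ‹Nonempty K›
  obtain ⟨m, m', hne⟩ := Fintype.one_lt_card_iff.mp hM
  have one_le_card : (1 : ℝ) ≤
      (Finset.univ.filter (fun k' : K => h k' m = h k m ∧ h k' m' = h k m')).card := by
    exact_mod_cast Finset.card_pos.mpr ⟨k, by simp⟩
  rw [ge_iff_le, div_le_iff₀ (by positivity)]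
  calc (1 : ℝ) ≤ ε * (Finset.univ.filter (fun k' : K => h k' m = h k m)).card :=
        one_le_card.trans (hsub m m' hne _ _)
    _ ≤ ε * (ε * Fintype.card K) := mul_le_mul_of_nonneg_left (himp m _) hε.le
    _ = Fintype.card K * ε ^ 2 := by ring
end

section
/- (Nonorthogonal states cannot be rejected with certainty.) Let E be a d×d complex matrix that is positive semidefinite and such that 1 − E is also positive semidefinite, and let ψ, φ ∈ ℂ^d be unit vectors with ⟨ψ, Eψ⟩ = 1 and ⟨ψ, φ⟩ ≠ 0. Then the acceptance probability of φ is strictly positive: Re⟨φ, Eφ⟩ > 0. -/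
open Matrix ComplexOrder

/-- Nonorthogonal states cannot be rejected with certainty: if the POVM element `E`
accepts the unit vector `ψ` with probability `1` and the unit vector `φ` satisfies
`⟨ψ, φ⟩ ≠ 0`, then the acceptance probability `Re⟨φ, Eφ⟩` of `φ` is strictly positive. -/
theorem povm_nonorthogonal_accepted_with_positive_probability
    {d : ℕ} (E : Matrix (Fin d) (Fin d) ℂ)
    (hE : E.PosSemidef)
    (hE' : ((1 : Matrix (Fin d) (Fin d) ℂ) - E).PosSemidef)
    (ψ φ : Fin d → ℂ)
    (hψ : star ψ ⬝ᵥ ψ = 1)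
    (hφ : star φ ⬝ᵥ φ = 1)
    (hacc : star ψ ⬝ᵥ (E *ᵥ ψ) = 1)
    (hover : star ψ ⬝ᵥ φ ≠ 0) :
    0 < (star φ ⬝ᵥ (E *ᵥ φ)).re := by
  have hEψ : E *ᵥ ψ = ψ := by
    have h : (1 - E) *ᵥ ψ = 0 := by
      rw [← hE'.dotProduct_mulVec_zero_iff, sub_mulVec, one_mulVec, dotProduct_sub, hψ, hacc,
        sub_self]
    rw [sub_mulVec, one_mulVec, sub_eq_zero] at h
    exact h.symm
  have hne : star φ ⬝ᵥ (E *ᵥ φ) ≠ 0 := by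
    rw [ne_eq, hE.dotProduct_mulVec_zero_iff]
    intro hEφ
    apply hover
    rw [← hEψ, star_mulVec, hE.isHermitian.eq, ← dotProduct_mulVec, hEφ, dotProduct_zero]
  exact (Complex.pos_iff.mp ((hE.dotProduct_mulVec_nonneg φ).lt_of_ne' hne)).1
end

section
/- (Theorem 2: prepare-and-measure QMACs with deterministic decision making cannot attain the classical impersonation bound 1/|T|.) Let T be a finite set of labels with |T| ≥ 2, let Ψ : T → ℂ^d assign to each label τ a unit vector (the quantum tag), and let E : T → (d×d complex matrices) assign to each label a POVM acceptance element, i.e., E(τ) and 1 − E(τ) are positive semidefinite. Assume deterministic acceptance of valid tags: ⟨Ψ(τ), E(τ)Ψ(τ)⟩ = 1 for every τ ∈ T. If there exist distinct labels τ ≠ τ′ with ⟨Ψ(τ), Ψ(τ′)⟩ ≠ 0, then there exists a label τ₀ ∈ T such that (1/|T|) · Σ_{τ ∈ T} Re⟨Ψ(τ₀), E(τ)Ψ(τ₀)⟩ > 1/|T|. That is, an impersonating adversary who sends the tag Ψ(τ₀), while the unknown key makes Bob verify against the uniformly random expected label τ, succeeds with probability strictly greater than 1/|T|. -/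
open Matrix ComplexOrder

/-- A vector accepted with certainty by an effect `A ≤ 1` is a fixed vector of `A`. -/
theorem Matrix.mulVec_eq_self_of_dotProduct_mulVec_eq {𝕜 n : Type*} [RCLike 𝕜] [Fintype n]
    [DecidableEq n] {A : Matrix n n 𝕜} (hA : (1 - A).PosSemidef) {x : n → 𝕜}
    (hx : star x ⬝ᵥ (A *ᵥ x) = star x ⬝ᵥ x) : A *ᵥ x = x := by
  have h : (1 - A) *ᵥ x = 0 := by
    rw [← hA.dotProduct_mulVec_zero_iff, sub_mulVec, one_mulVec, dotProduct_sub, hx, sub_self]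
  rw [sub_mulVec, one_mulVec, sub_eq_zero] at h
  exact h.symm

/-- A positive semidefinite matrix fixing `x` has positive expectation at every vector that is
not orthogonal to `x`. -/
theorem Matrix.PosSemidef.dotProduct_mulVec_pos_of_mulVec_eq_self {𝕜 n : Type*} [RCLike 𝕜]
    [Fintype n] {A : Matrix n n 𝕜} (hA : A.PosSemidef) {x y : n → 𝕜}
    (hx : A *ᵥ x = x) (hxy : star x ⬝ᵥ y ≠ 0) : 0 < star y ⬝ᵥ (A *ᵥ y) := by
  refine lt_of_le_of_ne (hA.dotProduct_mulVec_nonneg y) fun h => hxy ?_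
  have hy : A *ᵥ y = 0 := (hA.dotProduct_mulVec_zero_iff y).1 h.symm
  rw [← hx, star_mulVec, hA.isHermitian.eq, ← dotProduct_mulVec, hy, dotProduct_zero]

/-- Theorem 2: a prepare-and-measure QMAC with deterministic decision making cannot attain
the classical impersonation bound `1/|T|`.  If each label `τ` has a unit quantum tag `Ψ τ`
and a POVM acceptance element `E τ` accepting the valid tag with probability `1`, and two
distinct tags are nonorthogonal, then some impersonation state `Ψ τ₀` is accepted, on
average over the uniformly random expected label, with probability strictly greater than
`1/|T|`. -/
theorem qmac_deterministic_impersonation_above_classical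
    {T : Type*} [Fintype T] [DecidableEq T] (hT : 2 ≤ Fintype.card T)
    {d : ℕ} (Ψ : T → (Fin d → ℂ)) (E : T → Matrix (Fin d) (Fin d) ℂ)
    (hunit : ∀ τ : T, star (Ψ τ) ⬝ᵥ Ψ τ = 1)
    (hpos : ∀ τ : T, (E τ).PosSemidef)
    (hpos' : ∀ τ : T, ((1 : Matrix (Fin d) (Fin d) ℂ) - E τ).PosSemidef)
    (hdet : ∀ τ : T, star (Ψ τ) ⬝ᵥ (E τ *ᵥ Ψ τ) = 1)
    (hover : ∃ τ τ' : T, τ ≠ τ' ∧ star (Ψ τ) ⬝ᵥ Ψ τ' ≠ 0) :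
    ∃ τ₀ : T,
      (1 / (Fintype.card T : ℝ)) *
          ∑ τ : T, (star (Ψ τ₀) ⬝ᵥ (E τ *ᵥ Ψ τ₀)).re >
        1 / (Fintype.card T : ℝ) := by
  obtain ⟨τ, τ', hne, hov⟩ := hover
  refine ⟨τ', ?_⟩
  have hfix : E τ *ᵥ Ψ τ = Ψ τ :=
    mulVec_eq_self_of_dotProduct_mulVec_eq (hpos' τ) ((hdet τ).trans (hunit τ).symm)
  have hτ : 0 < (star (Ψ τ') ⬝ᵥ (E τ *ᵥ Ψ τ')).re :=
    (Complex.lt_def.1 ((hpos τ).dotProduct_mulVec_pos_of_mulVec_eq_self hfix hov)).1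
  have hτ' : (star (Ψ τ') ⬝ᵥ (E τ' *ᵥ Ψ τ')).re = 1 := by rw [hdet, Complex.one_re]
  have hsum : 1 < ∑ σ : T, (star (Ψ τ') ⬝ᵥ (E σ *ᵥ Ψ τ')).re := by
    rw [← hτ']
    exact Finset.single_lt_sum hne (Finset.mem_univ τ') (Finset.mem_univ τ) hτ fun σ _ _ =>
      (Complex.le_def.1 ((hpos σ).dotProduct_mulVec_nonneg (Ψ τ'))).1
  have hcard : (0 : ℝ) < 1 / (Fintype.card T : ℝ) := by
    have : 0 < Fintype.card T := by omega
    positivity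
  exact lt_mul_of_one_lt_right hcard hsum
end
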